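/- Let ℓ be an odd prime and let H be a proper normal subgroup of GL₂(ℤ/ℓℤ) such that the image of H under the determinant map is all of (ℤ/ℓℤ)^×. Then the index [GL₂(ℤ/ℓℤ) : H] is divisible by ℓ. -/

import Mathlib

def upT {R : Type*} [CommRing R] (t : R) : GL (Fin 2) R where
  val := !![1, t; 0, 1]
  inv := !![1, -t; 0, 1]
  val_inv := by ext i j; fin_cases i <;> fin_cases j <;> simp
  inv_val := by ext i j; fin_cases i <;> fin_cases j <;> simp

def loT {R : Type*} [CommRing R] (t : R) : GL (Fin 2) R where
  val := !![1, 0; t, 1]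
  inv := !![1, 0; -t, 1]
  val_inv := by ext i j; fin_cases i <;> fin_cases j <;> simp
  inv_val := by ext i j; fin_cases i <;> fin_cases j <;> simp

theorem upT_pow {R : Type*} [CommRing R] (t : R) (n : ℕ) : upT t ^ n = upT (n * t) := by
  induction n with
  | zero => ext i j; fin_cases i <;> fin_cases j <;> simp [upT]
  | succ k ih =>
    rw [pow_succ, ih]
    ext i j; fin_cases i <;> fin_cases j <;> simp [upT]
    ring

theorem loT_pow {R : Type*} [CommRing R] (t : R) (n : ℕ) : loT t ^ n = loT (n * t) := by
  induction n with
  | zero => ext i j; fin_cases i <;> fin_cases j <;> simp [loT]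
  | succ k ih =>
    rw [pow_succ, ih]
    ext i j; fin_cases i <;> fin_cases j <;> simp [loT]
    ring

theorem upT_zero {R : Type*} [CommRing R] : upT (0 : R) = 1 := by
  ext i j; fin_cases i <;> fin_cases j <;> simp [upT]

theorem loT_zero {R : Type*} [CommRing R] : loT (0 : R) = 1 := by
  ext i j; fin_cases i <;> fin_cases j <;> simp [loT]

theorem mem_of_pow_eq_one {G : Type*} [Group G] (H : Subgroup G) [H.Normal] {p : ℕ}
    (hp : p.Prime) (h : ¬ p ∣ H.index) (g : G) (hg : g ^ p = 1) : g ∈ H := by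
  have h1 : g ^ H.index ∈ H := H.pow_index_mem g
  have h2 : (QuotientGroup.mk g : G ⧸ H) ^ H.index = 1 := by
    rw [← QuotientGroup.mk_pow]; exact (QuotientGroup.eq_one_iff _).2 h1
  have h3 : (QuotientGroup.mk g : G ⧸ H) ^ p = 1 := by
    rw [← QuotientGroup.mk_pow, hg]; rfl
  rw [← QuotientGroup.eq_one_iff]
  have h4 : orderOf (QuotientGroup.mk g : G ⧸ H) ∣ Nat.gcd p H.index :=
    Nat.dvd_gcd (orderOf_dvd_of_pow_eq_one h3) (orderOf_dvd_of_pow_eq_one h2)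
  rw [(Nat.Prime.coprime_iff_not_dvd hp).2 h] at h4
  exact orderOf_eq_one_iff.1 (Nat.dvd_one.1 h4)

theorem mem_of_transvections {F : Type*} [Field F] (H : Subgroup (GL (Fin 2) F))
    (hu : ∀ t, upT t ∈ H) (hl : ∀ t, loT t ∈ H) (g : GL (Fin 2) F)
    (hg : g.val.det = 1) : g ∈ H := by
  have key : ∀ g : GL (Fin 2) F, g.val.det = 1 → g 1 0 ≠ 0 → g ∈ H := by
    intro g hg hc
    have : g = upT ((g 0 0 - 1) / g 1 0) * loT (g 1 0) * upT ((g 1 1 - 1) / g 1 0) := by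
      rw [Matrix.det_fin_two] at hg
      ext i j
      fin_cases i <;> fin_cases j <;> simp [upT, loT] <;> field_simp <;> grind
    rw [this]
    exact H.mul_mem (H.mul_mem (hu _) (hl _)) (hu _)
  by_cases hc : g 1 0 = 0
  · have h1 : loT 1 * g ∈ H := by
      apply key
      · simp only [Units.val_mul, Matrix.det_mul, hg, mul_one]
        simp [loT]
      · rw [Matrix.det_fin_two] at hg
        have : (loT 1 * g : GL (Fin 2) F) 1 0 = g 0 0 + g 1 0 := by
          simp [loT, Matrix.mul_apply, Fin.sum_univ_two]
        rw [this]
        intro h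
        grind
    exact (H.mul_mem_cancel_left (hl 1)).1 h1
  · exact key g hg hc

/-- A proper normal subgroup of `GL₂(ℤ/ℓℤ)` (`ℓ` an odd prime) whose image
under the determinant map is all of `(ℤ/ℓℤ)ˣ` has index divisible by `ℓ`. -/
theorem stmt2 (ℓ : ℕ) (hℓ : ℓ.Prime) (hodd : Odd ℓ)
    (H : Subgroup (GL (Fin 2) (ZMod ℓ))) (hnormal : H.Normal) (hproper : H ≠ ⊤)
    (hdet : Subgroup.map (Matrix.GeneralLinearGroup.det) H = ⊤) :
    ℓ ∣ H.index := by
  by_contra h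
  haveI : Fact ℓ.Prime := ⟨hℓ⟩
  apply hproper
  have hs : ∀ g : GL (Fin 2) (ZMod ℓ), g.val.det = 1 → g ∈ H := by
    apply mem_of_transvections
    · intro t
      apply mem_of_pow_eq_one H hℓ h
      rw [upT_pow]; simp [upT_zero]
    · intro t
      apply mem_of_pow_eq_one H hℓ h
      rw [loT_pow]; simp [loT_zero]
  rw [eq_top_iff]
  intro g _
  have : Matrix.GeneralLinearGroup.det g ∈ Subgroup.map (Matrix.GeneralLinearGroup.det) H := by
    rw [hdet]; trivial
  obtain ⟨k, hk, hkg⟩ := this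
  have h2 : k⁻¹ * g ∈ H := by
    apply hs
    have : Matrix.GeneralLinearGroup.det (k⁻¹ * g) = 1 := by
      rw [map_mul, map_inv, hkg, inv_mul_cancel]
    simpa using congrArg Units.val this
  exact (H.mul_mem_cancel_left (H.inv_mem hk)).1 h2
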